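/- Let X be a connected simple graph containing at least two distinct cycle subgraphs. Then X contains a subgraph isomorphic to a barbell graph or a subgraph isomorphic to a θ-graph. -/

import Mathlib

open SimpleGraph

/-- `X` contains a barbell subgraph: either two vertex-disjoint cycles joined by a path
whose inner vertices avoid both cycles, or two cycles meeting in exactly one vertex
(joined by the trivial path at that vertex). -/
def HasBarbell {V : Type*} (X : SimpleGraph V) : Prop :=
  ∃ (a b : V) (c₁ : X.Walk a a) (c₂ : X.Walk b b) (p : X.Walk a b),
    c₁.IsCycle ∧ c₂.IsCycle ∧ p.IsPath ∧
      (((∀ x : V, x ∈ c₁.support → x ∉ c₂.support) ∧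
          ∀ x : V, x ∈ p.support → x ≠ a → x ≠ b → x ∉ c₁.support ∧ x ∉ c₂.support) ∨
        (a = b ∧ p.length = 0 ∧ ∀ x : V, x ∈ c₁.support → x ∈ c₂.support → x = a))

/-- `X` contains a θ-subgraph: two distinct vertices `v` and `w` joined by three distinct
paths that are pairwise disjoint except at their common endpoints `v` and `w`. -/
def HasTheta {V : Type*} (X : SimpleGraph V) : Prop :=
  ∃ (v w : V) (p₁ p₂ p₃ : X.Walk v w),
    v ≠ w ∧ p₁.IsPath ∧ p₂.IsPath ∧ p₃.IsPath ∧
      p₁ ≠ p₂ ∧ p₁ ≠ p₃ ∧ p₂ ≠ p₃ ∧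
      (∀ x : V, x ∈ p₁.support → x ∈ p₂.support → x = v ∨ x = w) ∧
      (∀ x : V, x ∈ p₁.support → x ∈ p₃.support → x = v ∨ x = w) ∧
      (∀ x : V, x ∈ p₂.support → x ∈ p₃.support → x = v ∨ x = w)

namespace SimpleGraph.Walk

variable {V : Type*} {X : SimpleGraph V}

theorem length_pos_of_ne {a b : V} (p : X.Walk a b) (h : a ≠ b) : 0 < p.length :=
  Nat.pos_of_ne_zero fun h0 => h (eq_of_length_eq_zero h0)

/-- A cycle cut at two distinct vertices falls apart into two paths which are internally
disjoint and have no edge in common. -/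
theorem IsCycle.of_append {a b : V} {p : X.Walk a b} {q : X.Walk b a}
    (hc : (p.append q).IsCycle) (hab : a ≠ b) :
    p.IsPath ∧ q.IsPath ∧ (∀ x ∈ p.support, x ∈ q.support → x = a ∨ x = b) ∧
      p.edges.Disjoint q.edges := by
  have hs := hc.support_nodup
  have he := hc.edges_nodup
  rw [tail_support_append, List.nodup_append'] at hs
  rw [edges_append, List.nodup_append'] at he
  obtain ⟨hp, hq, hd⟩ := hs
  have hb : b ∈ p.support.tail := end_mem_tail_support_of_ne hab p
  have ha : a ∈ q.support.tail := end_mem_tail_support_of_ne hab.symm q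
  refine ⟨?_, ?_, fun x hxp hxq => ?_, he.2.2⟩
  · rw [isPath_def, ← cons_tail_support, List.nodup_cons]
    exact ⟨fun h => hd h ha, hp⟩
  · rw [isPath_def, ← cons_tail_support, List.nodup_cons]
    exact ⟨fun h => hd hb h, hq⟩
  · rcases (mem_support_iff p).1 hxp with h | h
    · exact .inl h
    · rcases (mem_support_iff q).1 hxq with h' | h'
      · exact .inr h'
      · exact (hd h h').elim

/-- A cycle through two distinct vertices `u` and `v` is the union of two paths from `u` to `v`
which are internally disjoint and have no edge in common. -/
theorem IsCycle.exists_paths {r u v : V} {c : X.Walk r r} (hc : c.IsCycle)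
    (hu : u ∈ c.support) (hv : v ∈ c.support) (huv : u ≠ v) :
    ∃ p q : X.Walk u v, p.IsPath ∧ q.IsPath ∧
      (∀ x ∈ p.support, x ∈ q.support → x = u ∨ x = v) ∧ p.edges.Disjoint q.edges ∧
      (∀ x, x ∈ c.support ↔ x ∈ p.support ∨ x ∈ q.support) ∧
      ∀ e, e ∈ c.edges ↔ e ∈ p.edges ∨ e ∈ q.edges := by
  classical
  obtain ⟨p, q, h⟩ := mem_support_iff_exists_append.1 ((mem_support_rotate_iff c u hu).2 hv)
  obtain ⟨hp, hq, hs, he⟩ := (h ▸ hc.rotate hu : (p.append q).IsCycle).of_append huv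
  refine ⟨p, q.reverse, hp, hq.reverse, by simpa using hs, by simpa using he, fun x => ?_,
    fun e => ?_⟩
  · rw [← mem_support_rotate_iff c u hu, h]
    simp
  · rw [← (rotate_edges c u hu).mem_iff, h]
    simp

/-- A path between two sets of vertices contains one whose inner vertices avoid both sets. -/
theorem IsPath.exists_isPath_inner_notMem (S T : Set V) {a b : V} {p : X.Walk a b}
    (hp : p.IsPath) (ha : a ∈ S) (hb : b ∈ T) :
    ∃ (a' b' : V) (p' : X.Walk a' b'), a' ∈ S ∧ b' ∈ T ∧ p'.IsPath ∧
      ∀ x ∈ p'.support, x ≠ a' → x ≠ b' → x ∉ S ∧ x ∉ T := by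
  induction hn : p.length using Nat.strong_induction_on generalizing a b with
  | _ n ih =>
    by_cases h : ∀ x ∈ p.support, x ≠ a → x ≠ b → x ∉ S ∧ x ∉ T
    · exact ⟨a, b, p, ha, hb, hp, h⟩
    · push Not at h
      obtain ⟨x, hx, hxa, hxb, hST⟩ := h
      obtain ⟨q, r, hq, hr, rfl⟩ := hp.mem_support_iff_exists_append.1 hx
      have hq0 := q.length_pos_of_ne hxa.symm
      have hr0 := r.length_pos_of_ne hxb
      rw [length_append] at hn
      by_cases hxS : x ∈ S
      · exact ih r.length (by lia) hr hxS hb rfl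
      · exact ih q.length (by lia) hq ha (hST hxS) rfl

/-- A path with distinct ends in `S` and an edge outside `E` contains such a path whose inner
vertices avoid `S`. -/
theorem IsPath.exists_ear (S : Set V) (E : Set (Sym2 V)) {a b : V} {p : X.Walk a b}
    (hp : p.IsPath) (ha : a ∈ S) (hb : b ∈ S) (hab : a ≠ b) (he : ∃ e ∈ p.edges, e ∉ E) :
    ∃ (a' b' : V) (p' : X.Walk a' b'), a' ∈ S ∧ b' ∈ S ∧ a' ≠ b' ∧ p'.IsPath ∧
      (∃ e ∈ p'.edges, e ∉ E) ∧ ∀ x ∈ p'.support, x ∈ S → x = a' ∨ x = b' := by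
  induction hn : p.length using Nat.strong_induction_on generalizing a b with
  | _ n ih =>
    by_cases h : ∀ x ∈ p.support, x ∈ S → x = a ∨ x = b
    · exact ⟨a, b, p, ha, hb, hab, hp, he, h⟩
    · push Not at h
      obtain ⟨x, hx, hxS, hxa, hxb⟩ := h
      obtain ⟨q, r, hq, hr, rfl⟩ := hp.mem_support_iff_exists_append.1 hx
      have hq0 := q.length_pos_of_ne hxa.symm
      have hr0 := r.length_pos_of_ne hxb
      rw [length_append] at hn
      obtain ⟨e, hep, heE⟩ := he
      rw [edges_append, List.mem_append] at hep
      rcases hep with h | h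
      · exact ih q.length (by lia) hq ha hxS hxa.symm ⟨e, h, heE⟩ rfl
      · exact ih r.length (by lia) hr hxS hb hxb ⟨e, h, heE⟩ rfl

/-- Two cycles with the same edges have the same subgraph. -/
theorem IsCycle.toSubgraph_eq_of_edges {a b : V} {c : X.Walk a a} {d : X.Walk b b}
    (hc : c.IsCycle) (hd : d.IsCycle) (h : ∀ e, e ∈ c.edges ↔ e ∈ d.edges) :
    c.toSubgraph = d.toSubgraph := by
  ext x y
  · rw [mem_verts_toSubgraph, mem_verts_toSubgraph,
      mem_support_iff_exists_mem_edges_of_not_nil hc.not_nil,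
      mem_support_iff_exists_mem_edges_of_not_nil hd.not_nil]
    simp only [h]
  · rw [adj_toSubgraph_iff_mem_edges, adj_toSubgraph_iff_mem_edges, h]

/-- Two cycles sharing two vertices, one of them with an edge outside the other, contain a
θ-graph. -/
theorem IsCycle.hasTheta {a b u v : V} {c : X.Walk a a} {d : X.Walk b b}
    (hc : c.IsCycle) (hd : d.IsCycle) (huv : u ≠ v) (huc : u ∈ c.support) (hvc : v ∈ c.support)
    (hud : u ∈ d.support) (hvd : v ∈ d.support) {e : Sym2 V} (hed : e ∈ d.edges)
    (hec : e ∉ c.edges) : HasTheta X := by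
  obtain ⟨p, q, hp, hq, -, -, -, hpq⟩ := hd.exists_paths hud hvd huv
  obtain ⟨v', w', s, hv', hw', hne, hs, ⟨f, hfs, hfc⟩, hsc⟩ :
      ∃ (a' b' : V) (p' : X.Walk a' b'), a' ∈ {x | x ∈ c.support} ∧ b' ∈ {x | x ∈ c.support} ∧
        a' ≠ b' ∧ p'.IsPath ∧ (∃ e ∈ p'.edges, e ∉ {e | e ∈ c.edges}) ∧
        ∀ x ∈ p'.support, x ∈ {x | x ∈ c.support} → x = a' ∨ x = b' := by
    rcases (hpq e).1 hed with h | h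
    · exact hp.exists_ear _ _ huc hvc huv ⟨e, h, hec⟩
    · exact hq.exists_ear _ _ huc hvc huv ⟨e, h, hec⟩
  obtain ⟨p₁, p₂, hp₁, hp₂, hdisj, hedges, hsupp, hcedges⟩ := hc.exists_paths hv' hw' hne
  refine ⟨v', w', p₁, p₂, s, hne, hp₁, hp₂, hs, ?_, ?_, ?_, hdisj,
    fun x h₁ h => hsc x h ((hsupp x).2 (.inl h₁)), fun x h₂ h => hsc x h ((hsupp x).2 (.inr h₂))⟩
  · rintro rfl
    have hpos := p₁.length_pos_of_ne hne
    rw [← length_edges, List.length_pos_iff_exists_mem] at hpos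
    obtain ⟨g, hg⟩ := hpos
    exact hedges hg hg
  · rintro rfl
    exact hfc ((hcedges f).2 (.inl hfs))
  · rintro rfl
    exact hfc ((hcedges f).2 (.inr hfs))

/-- In a connected graph, two cycles with at most one common vertex give a barbell. -/
theorem IsCycle.hasBarbell (hconn : X.Connected) {a b : V} {c : X.Walk a a} {d : X.Walk b b}
    (hc : c.IsCycle) (hd : d.IsCycle)
    (h : ∀ u v, u ∈ c.support → u ∈ d.support → v ∈ c.support → v ∈ d.support → u = v) :
    HasBarbell X := by
  classical
  by_cases hu : ∃ u, u ∈ c.support ∧ u ∈ d.support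
  · obtain ⟨u, huc, hud⟩ := hu
    refine ⟨u, u, c.rotate u huc, d.rotate u hud, .nil, hc.rotate huc, hd.rotate hud, .nil,
      .inr ⟨rfl, rfl, fun x hxc hxd => ?_⟩⟩
    rw [mem_support_rotate_iff] at hxc hxd
    exact h x u hxc hxd huc hud
  · push Not at hu
    obtain ⟨p, hp⟩ := hconn.exists_isPath a b
    obtain ⟨a', b', q, ha, hb, hq, hin⟩ := hp.exists_isPath_inner_notMem
      {x | x ∈ c.support} {x | x ∈ d.support} c.start_mem_support d.start_mem_support
    refine ⟨a', b', c.rotate a' ha, d.rotate b' hb, q, hc.rotate ha, hd.rotate hb, hq,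
      .inl ⟨fun x => ?_, fun x => ?_⟩⟩
    · simpa only [mem_support_rotate_iff] using hu x
    · simpa only [mem_support_rotate_iff] using! hin x

end SimpleGraph.Walk

/-- Any connected graph with at least two distinct cycle subgraphs contains a barbell
subgraph or a θ-subgraph. -/
theorem stmt14 {V : Type} (X : SimpleGraph V) (hconn : X.Connected)
    (htwo : ∃ (a b : V) (c₁ : X.Walk a a) (c₂ : X.Walk b b),
      c₁.IsCycle ∧ c₂.IsCycle ∧ c₁.toSubgraph ≠ c₂.toSubgraph) :
    HasBarbell X ∨ HasTheta X := by
  obtain ⟨a, b, c, d, hc, hd, hne⟩ := htwo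
  by_cases h : ∀ u v, u ∈ c.support → u ∈ d.support → v ∈ c.support → v ∈ d.support → u = v
  · exact .inl (hc.hasBarbell hconn hd h)
  · push Not at h
    obtain ⟨u, v, huc, hud, hvc, hvd, huv⟩ := h
    obtain ⟨e, he⟩ := not_forall.1 (mt (hc.toSubgraph_eq_of_edges hd) hne)
    by_cases hec : e ∈ c.edges
    · have hed : e ∉ d.edges := fun hed => he (iff_of_true hec hed)
      exact .inr (hd.hasTheta hc huv hud hvd huc hvc hec hed)
    · have hed : e ∈ d.edges := by_contra fun hed => he (iff_of_false hec hed)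
      exact .inr (hc.hasTheta hd huv huc hvc hud hvd hed hec)
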